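/- arXiv:1902.05619 — 2 statements merged into one kernel-verified Lean document; each statement's English description precedes it below -/
import Mathlib

section
/- Let T > 0, let V be a probability vector field on ℝ^d and let μ : [0,T] → 𝒫(ℝ^d), t ↦ μ_t, be a Borel family of probability measures such that ∫₀^T ∫_{Tℝ^d} |v| dV[μ_t](x,v) dt < +∞. Then μ is a solution of the measure differential equation μ̇_t = V[μ_t] if and only if μ is a distributional solution of the nonlocal continuity equation ∂_t μ_t + div(w[μ_t] μ_t) = 0, where the Borel vector field w is defined for μ-a.e. x ∈ ℝ^d by w[μ](x) = ∫_{π₁⁻¹(x)} v dν_x[μ](v), with ν_x[μ] the disintegration of V[μ] with respect to π₁. -/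
open MeasureTheory Set Filter Topology Metric
open scoped ENNReal NNReal Classical

noncomputable section

abbrev Euc (d : ℕ) : Type := EuclideanSpace ℝ (Fin d)

/-- The (topological) support of a measure. -/
def msupp {X : Type*} [TopologicalSpace X] [MeasurableSpace X] (μ : Measure X) : Set X :=
  {x | ∀ U : Set X, IsOpen U → x ∈ U → 0 < μ U}

/-- Compactly supported Borel probability measures (membership in `𝒫_c`). -/
def Pc {X : Type*} [TopologicalSpace X] [MeasurableSpace X] (μ : Measure X) : Prop :=
  IsProbabilityMeasure μ ∧ ∃ K : Set X, IsCompact K ∧ μ Kᶜ = 0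

/-- A probability vector field: `π₁ ♯ V[μ] = μ`. -/
def IsPVF {d : ℕ} (V : Measure (Euc d) → Measure (Euc d × Euc d)) : Prop :=
  ∀ μ : Measure (Euc d), IsProbabilityMeasure μ →
    IsProbabilityMeasure (V μ) ∧ (V μ).map Prod.fst = μ

/-- Solution of the measure differential equation `μ̇_t = V[μ_t]` on `[0,T]`. -/
def IsMDESol {d : ℕ} (T : ℝ) (V : Measure (Euc d) → Measure (Euc d × Euc d))
    (μ : ℝ → Measure (Euc d)) : Prop :=
  ∀ f : Euc d → ℝ, ContDiff ℝ (⊤ : ℕ∞) f → HasCompactSupport f →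
    IntegrableOn (fun t => ∫ p : Euc d × Euc d, fderiv ℝ f p.1 p.2 ∂(V (μ t))) (Icc 0 T) ∧
    ∀ t ∈ Icc (0 : ℝ) T,
      (∫ x, f x ∂(μ t)) - (∫ x, f x ∂(μ 0)) =
        ∫ s in Icc (0 : ℝ) t, (∫ p : Euc d × Euc d, fderiv ℝ f p.1 p.2 ∂(V (μ s)))

/-- 1-Wasserstein distance via the Kantorovich–Rubinstein duality. -/
def W1 {X : Type*} [MeasurableSpace X] [PseudoMetricSpace X] (μ ν : Measure X) : ℝ :=
  ⨆ f : {f : X → ℝ // LipschitzWith 1 f}, ((∫ x, f.1 x ∂μ) - ∫ x, f.1 x ∂ν)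

/-- Disintegration `ν_x[·]` of a measure on a product space w.r.t. the first projection. -/
def disint {d : ℕ} (m : Measure (Euc d × Euc d)) : Euc d → Measure (Euc d) :=
  if h : IsFiniteMeasure m then
    haveI := h
    fun x => m.condKernel x
  else fun _ => 0

/-- Barycenter of the disintegration: `x ↦ ∫ v dν_x(v)`. -/
def bary {d : ℕ} (m : Measure (Euc d × Euc d)) (x : Euc d) : Euc d :=
  ∫ v, v ∂(disint m x)


/-- Distributional solution of the nonlocal continuity equation
`∂_t μ_t + div(w[μ_t] μ_t) = 0` on `[0,T]`. -/
def IsCESol {d : ℕ} (T : ℝ) (w : ℝ → Euc d → Euc d) (μ : ℝ → Measure (Euc d)) : Prop :=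
  (∫⁻ t in Icc (0 : ℝ) T, ∫⁻ x, ‖w t x‖₊ ∂(μ t)) < ⊤ ∧
  ∀ f : Euc d → ℝ, ContDiff ℝ (⊤ : ℕ∞) f → HasCompactSupport f →
    ∀ t ∈ Icc (0 : ℝ) T,
      (∫ x, f x ∂(μ t)) - (∫ x, f x ∂(μ 0)) =
        ∫ s in Icc (0 : ℝ) t, (∫ x, fderiv ℝ f x (w s x) ∂(μ s))

theorem bary_eq_integral_condKernel {d : ℕ} (m : Measure (Euc d × Euc d)) [IsFiniteMeasure m]
    (x : Euc d) : bary m x = ∫ v, v ∂(m.condKernel x) := by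
  unfold bary disint
  rw [dif_pos (inferInstance : IsFiniteMeasure m)]

theorem lintegral_nnnorm_bary_le {d : ℕ} (m : Measure (Euc d × Euc d)) [IsFiniteMeasure m] :
    ∫⁻ x, ‖bary m x‖₊ ∂m.fst ≤ ∫⁻ p, ‖p.2‖₊ ∂m := by
  rw [← Measure.lintegral_condKernel (ρ := m)
    (f := fun p : Euc d × Euc d => (‖p.2‖₊ : ℝ≥0∞)) (by fun_prop)]
  refine lintegral_mono fun x => ?_
  rw [bary_eq_integral_condKernel]
  exact enorm_integral_le_lintegral_enorm _

theorem norm_fderiv_apply_snd_le {d : ℕ} {f : Euc d → ℝ} {C : ℝ}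
    (hC : ∀ x, ‖fderiv ℝ f x‖ ≤ C) (p : Euc d × Euc d) :
    ‖fderiv ℝ f p.1 p.2‖ ≤ C * ‖p.2‖ :=
  (fderiv ℝ f p.1).le_of_opNorm_le (hC _) _

theorem continuous_fderiv_apply_snd {d : ℕ} {f : Euc d → ℝ}
    (hf : ContDiff ℝ (⊤ : ℕ∞) f) :
    Continuous fun p : Euc d × Euc d => fderiv ℝ f p.1 p.2 :=
  ((hf.continuous_fderiv (by simp)).comp continuous_fst).clm_apply continuous_snd

theorem exists_norm_fderiv_le {d : ℕ} {f : Euc d → ℝ}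
    (hf : ContDiff ℝ (⊤ : ℕ∞) f) (hs : HasCompactSupport f) :
    ∃ C, ∀ x, ‖fderiv ℝ f x‖ ≤ C :=
  (hf.continuous_fderiv (by simp)).bounded_above_of_compact_support (hs.fderiv ℝ)

theorem integrable_snd_of_lintegral_lt_top {d : ℕ} {m : Measure (Euc d × Euc d)}
    (hm : ∫⁻ p, ‖p.2‖₊ ∂m < ⊤) : Integrable Prod.snd m :=
  ⟨measurable_snd.aestronglyMeasurable, hm⟩

theorem integral_fderiv_eq_integral_bary {d : ℕ} {m : Measure (Euc d × Euc d)} [IsFiniteMeasure m]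
    (hm : ∫⁻ p, ‖p.2‖₊ ∂m < ⊤) {f : Euc d → ℝ}
    (hf : ContDiff ℝ (⊤ : ℕ∞) f) (hs : HasCompactSupport f) :
    ∫ p, fderiv ℝ f p.1 p.2 ∂m = ∫ x, fderiv ℝ f x (bary m x) ∂m.fst := by
  obtain ⟨C, hC⟩ := exists_norm_fderiv_le hf hs
  have hsnd := integrable_snd_of_lintegral_lt_top hm
  have hint : Integrable (fun p : Euc d × Euc d => fderiv ℝ f p.1 p.2) m :=
    (hsnd.norm.const_mul C).mono' (continuous_fderiv_apply_snd hf).aestronglyMeasurable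
      (ae_of_all _ (norm_fderiv_apply_snd_le hC))
  rw [← Measure.integral_condKernel hint]
  refine integral_congr_ae ?_
  filter_upwards [hsnd.condKernel_ae] with x hx
  rw [bary_eq_integral_condKernel]
  exact (fderiv ℝ f x).integral_comp_comm hx

/-- Proposition `prop:equivMDE-CE`: `μ` solves the MDE `μ̇_t = V[μ_t]`
iff it solves the nonlocal continuity equation driven by the barycentric velocity field
`w[μ](x) = ∫ v dν_x[μ](v)`, where `ν_x[μ]` is the disintegration of `V[μ]` w.r.t. `π₁`. -/
theorem mde_iff_nonlocal_continuity {d : ℕ} (T : ℝ) (hT : 0 < T)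
    (V : Measure (Euc d) → Measure (Euc d × Euc d)) (hV : IsPVF V)
    (μ : ℝ → Measure (Euc d))
    (hprob : ∀ t ∈ Icc (0 : ℝ) T, IsProbabilityMeasure (μ t))
    (hborel : ∀ s : Set (Euc d), MeasurableSet s → Measurable fun t => μ t s)
    (hborelV : ∀ s : Set (Euc d × Euc d), MeasurableSet s → Measurable fun t => V (μ t) s)
    (hint : (∫⁻ t in Icc (0 : ℝ) T, ∫⁻ p : Euc d × Euc d, ‖p.2‖₊ ∂(V (μ t))) < ⊤) :
    IsMDESol T V μ ↔ IsCESol T (fun t x => bary (V (μ t)) x) μ := by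
  have hVp : ∀ t ∈ Icc (0 : ℝ) T, IsProbabilityMeasure (V (μ t)) :=
    fun t ht => (hV _ (hprob t ht)).1
  have hfst : ∀ t ∈ Icc (0 : ℝ) T, (V (μ t)).fst = μ t :=
    fun t ht => (hV _ (hprob t ht)).2
  have hmeas : Measurable fun t => V (μ t) := Measure.measurable_of_measurable_coe _ hborelV
  have hmoment : Measurable fun t => ∫⁻ p : Euc d × Euc d, ‖p.2‖₊ ∂(V (μ t)) :=
    (Measure.measurable_lintegral (by fun_prop)).comp hmeas
  have hfin : ∀ᵐ t ∂(volume.restrict (Icc (0 : ℝ) T)),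
      ∫⁻ p : Euc d × Euc d, ‖p.2‖₊ ∂(V (μ t)) < ⊤ :=
    ae_lt_top hmoment hint.ne
  have hflux : ∀ f : Euc d → ℝ, ContDiff ℝ (⊤ : ℕ∞) f → HasCompactSupport f →
      ∀ᵐ t ∂(volume.restrict (Icc (0 : ℝ) T)),
        ∫ p : Euc d × Euc d, fderiv ℝ f p.1 p.2 ∂(V (μ t)) =
          ∫ x, fderiv ℝ f x (bary (V (μ t)) x) ∂(μ t) := by
    intro f hf hs
    filter_upwards [hfin, ae_restrict_mem measurableSet_Icc] with t ht htT
    have := hVp t htT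
    rw [integral_fderiv_eq_integral_bary ht hf hs, hfst t htT]
  have hfluxInt : ∀ f : Euc d → ℝ, ContDiff ℝ (⊤ : ℕ∞) f → HasCompactSupport f →
      ∀ t ∈ Icc (0 : ℝ) T,
        ∫ s in Icc (0 : ℝ) t, (∫ p : Euc d × Euc d, fderiv ℝ f p.1 p.2 ∂(V (μ s))) =
          ∫ s in Icc (0 : ℝ) t, (∫ x, fderiv ℝ f x (bary (V (μ s)) x) ∂(μ s)) :=
    fun f hf hs t ht => integral_congr_ae
      (ae_restrict_of_ae_restrict_of_subset (Icc_subset_Icc_right ht.2) (hflux f hf hs))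
  constructor
  · intro h
    refine ⟨lt_of_le_of_lt (setLIntegral_mono' measurableSet_Icc fun t ht => ?_) hint,
      fun f hf hs t ht => ?_⟩
    · have := hVp t ht
      simpa only [hfst t ht] using lintegral_nnnorm_bary_le (V (μ t))
    · rw [← hfluxInt f hf hs t ht]
      exact (h f hf hs).2 t ht
  · intro h f hf hs
    refine ⟨?_, fun t ht => ?_⟩
    · obtain ⟨C, hC⟩ := exists_norm_fderiv_le hf hs
      have hC0 : 0 ≤ C := (norm_nonneg _).trans (hC 0)
      let κ : ProbabilityTheory.Kernel ℝ (Euc d × Euc d) := ⟨fun t => V (μ t), hmeas⟩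
      have hsm : StronglyMeasurable fun t =>
          ∫ p : Euc d × Euc d, fderiv ℝ f p.1 p.2 ∂(V (μ t)) :=
        StronglyMeasurable.integral_kernel (κ := κ)
          (continuous_fderiv_apply_snd hf).stronglyMeasurable
      refine ⟨hsm.aestronglyMeasurable, ?_⟩
      calc ∫⁻ t in Icc (0 : ℝ) T, ‖∫ p : Euc d × Euc d, fderiv ℝ f p.1 p.2 ∂(V (μ t))‖ₑ
          ≤ ∫⁻ t in Icc (0 : ℝ) T,
              ENNReal.ofReal C * ∫⁻ p : Euc d × Euc d, ‖p.2‖₊ ∂(V (μ t)) := by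
            refine lintegral_mono fun t => (enorm_integral_le_lintegral_enorm _).trans ?_
            rw [← lintegral_const_mul _ (by fun_prop)]
            refine lintegral_mono fun p => ?_
            rw [← ofReal_norm, ← enorm_eq_nnnorm, ← ofReal_norm,
              ← ENNReal.ofReal_mul hC0]
            exact ENNReal.ofReal_le_ofReal (norm_fderiv_apply_snd_le hC p)
        _ = ENNReal.ofReal C *
              ∫⁻ t in Icc (0 : ℝ) T, ∫⁻ p : Euc d × Euc d, ‖p.2‖₊ ∂(V (μ t)) :=
            lintegral_const_mul _ hmoment
        _ < ⊤ := ENNReal.mul_lt_top ENNReal.ofReal_lt_top hint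
    · rw [hfluxInt f hf hs t ht]
      exact h.2 f hf hs t ht

end
end

section
/- Let V be a probability vector field satisfying (H1) and (H2), μ₀ ∈ 𝒫_c(ℝ^d), and let μ = {μ_t}_{t∈[0,T]} be a solution of the MDE μ̇_t = V[μ_t] obtained as uniform-in-time limit, for the Wasserstein metric, of the Lattice Approximate Solutions μ^N. Let η^N ∈ 𝒫(Γ_{[0,T]}) be the probabilistic representations of the LASs built by the concatenation construction. Then, up to a subsequence, η^N converges weakly-* to some η ∈ 𝒫(Γ_{[0,T]}), and η is a probabilistic representation of μ, i.e. e_t♯η = μ_t for all t ∈ [0,T]. -/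
open MeasureTheory Set Filter Topology Metric
open scoped ENNReal NNReal Classical

noncomputable section

section Hypotheses

/-- Condition (H1) with a given constant `C`. -/
def H1cond {d : ℕ} (C : ℝ) (V : Measure (Euc d) → Measure (Euc d × Euc d)) : Prop :=
  ∀ μ : Measure (Euc d), Pc μ →
    ∀ p ∈ msupp (V μ), ‖p.2‖ ≤ C * (1 + ⨆ x : msupp μ, ‖(x : Euc d)‖)

/-- Hypothesis (H1): sublinearity of the PVF. -/
def H1 {d : ℕ} (V : Measure (Euc d) → Measure (Euc d × Euc d)) : Prop :=
  ∃ C > 0, H1cond C V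

/-- Hypothesis (H2): continuity of the PVF `V : 𝒫_c(ℝ^d) → 𝒫_c(Tℝ^d)` w.r.t. Wasserstein. -/
def H2 {d : ℕ} (V : Measure (Euc d) → Measure (Euc d × Euc d)) : Prop :=
  (∀ μ, Pc μ → Pc (V μ)) ∧
  ∀ μ, Pc μ → ∀ ε > 0, ∃ δ > 0, ∀ ν, Pc ν → W1 μ ν < δ → W1 (V μ) (V ν) < ε

/-- Transference plans between two measures. -/
def Couplings {X Y : Type*} [MeasurableSpace X] [MeasurableSpace Y]
    (μ : Measure X) (ν : Measure Y) : Set (Measure (X × Y)) :=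
  {π | π.map Prod.fst = μ ∧ π.map Prod.snd = ν}

/-- 1-Wasserstein distance as infimum over transference plans. -/
def Wplan {X : Type*} [MeasurableSpace X] [PseudoMetricSpace X] (μ ν : Measure X) : ℝ :=
  sInf ((fun π : Measure (X × X) => ∫ p, dist p.1 p.2 ∂π) '' Couplings μ ν)

/-- Optimal transference plans. -/
def OptCouplings {X : Type*} [MeasurableSpace X] [PseudoMetricSpace X] (μ ν : Measure X) :
    Set (Measure (X × X)) :=
  {π | π ∈ Couplings μ ν ∧ (∫ p, dist p.1 p.2 ∂π) = Wplan μ ν}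

/-- The quantity `𝒲(V₁,V₂)`: minimal fiber displacement over plans whose base marginal is
an optimal plan between the two base measures. -/
def Wfib {d : ℕ} (V₁ V₂ : Measure (Euc d × Euc d)) : ℝ :=
  sInf ((fun P : Measure ((Euc d × Euc d) × (Euc d × Euc d)) => ∫ q, ‖q.1.2 - q.2.2‖ ∂P) ''
    {P | P ∈ Couplings V₁ V₂ ∧
      P.map (fun q => (q.1.1, q.2.1)) ∈ OptCouplings (V₁.map Prod.fst) (V₂.map Prod.fst)})

/-- Hypothesis (H3): local Lipschitz continuity of the PVF in the `μ` variable. -/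
def H3 {d : ℕ} (V : Measure (Euc d) → Measure (Euc d × Euc d)) : Prop :=
  ∀ R > 0, ∃ L > 0, ∀ μ ν : Measure (Euc d), Pc μ → Pc ν →
    msupp μ ⊆ ball (0 : Euc d) R → msupp ν ⊆ ball (0 : Euc d) R →
    Wfib (V μ) (V ν) ≤ L * W1 μ ν

end Hypotheses

section Schemes

/-- The semi-discrete (in time) Lagrangian scheme at grid times `t_k = k T/N`. -/
def lagrStep {d : ℕ} (T : ℝ) (N : ℕ) (V : Measure (Euc d) → Measure (Euc d × Euc d))
    (μ₀ : Measure (Euc d)) : ℕ → Measure (Euc d)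
  | 0 => μ₀
  | k + 1 => (V (lagrStep T N V μ₀ k)).map fun p => p.1 + (T / N) • p.2

/-- Time interpolation of the semi-discrete Lagrangian scheme. -/
def lagrT {d : ℕ} (T : ℝ) (N : ℕ) (V : Measure (Euc d) → Measure (Euc d × Euc d))
    (μ₀ : Measure (Euc d)) (t : ℝ) : Measure (Euc d) :=
  if t ≤ 0 then μ₀
  else
    (V (lagrStep T N V μ₀ (⌈t / (T / N)⌉.toNat - 1))).map fun p =>
      p.1 + (t - (↑(⌈t / (T / N)⌉.toNat - 1) : ℝ) * (T / N)) • p.2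

/-- The mean velocity scheme at grid times `t_j = j T/N`. -/
def mvelStep {d : ℕ} (T : ℝ) (N : ℕ) (V : Measure (Euc d) → Measure (Euc d × Euc d))
    (μ₀ : Measure (Euc d)) : ℕ → Measure (Euc d)
  | 0 => μ₀
  | j + 1 => (mvelStep T N V μ₀ j).map fun x =>
      x + (T / N) • bary (V (mvelStep T N V μ₀ j)) x

/-- Time interpolation of the mean velocity scheme. -/
def mvelT {d : ℕ} (T : ℝ) (N : ℕ) (V : Measure (Euc d) → Measure (Euc d × Euc d))
    (μ₀ : Measure (Euc d)) (t : ℝ) : Measure (Euc d) :=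
  if t ≤ 0 then μ₀
  else
    (mvelStep T N V μ₀ (⌈t / (T / N)⌉.toNat - 1)).map fun x =>
      x + (t - (↑(⌈t / (T / N)⌉.toNat - 1) : ℝ) * (T / N)) •
        bary (V (mvelStep T N V μ₀ (⌈t / (T / N)⌉.toNat - 1))) x

end Schemes

section LAS

variable {d : ℕ}

/-- Space grid point (as a function), `x_i = Δ_N^x · i`. -/
def gx (T : ℝ) (N : ℕ) (i : Fin d → ℤ) (k : Fin d) : ℝ := (T / N ^ 2) * i k

/-- Velocity grid point (as a function), `v_j = Δ_N^v · j`. -/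
def gv (N : ℕ) (j : Fin d → ℤ) (k : Fin d) : ℝ := (1 / N) * j k

/-- Space grid point as an element of `ℝ^d`. -/
def gxE (T : ℝ) (N : ℕ) (i : Fin d → ℤ) : Euc d :=
  (EuclideanSpace.equiv (Fin d) ℝ).symm (gx T N i)

/-- Velocity grid point as an element of `ℝ^d`. -/
def gvE (N : ℕ) (j : Fin d → ℤ) : Euc d :=
  (EuclideanSpace.equiv (Fin d) ℝ).symm (gv N j)

/-- The space grid constraint `x_i ∈ [-N,N]^d`. -/
def okX (T : ℝ) (N : ℕ) (i : Fin d → ℤ) : Prop := ∀ k, |gx T N i k| ≤ N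

/-- The velocity grid constraint `v_j ∈ [-TN,TN]^d`. -/
def okV (T : ℝ) (N : ℕ) (j : Fin d → ℤ) : Prop := ∀ k, |gv N j k| ≤ T * N

/-- The cube `x_i + [0, Δ_N^x)^d`. -/
def boxX (T : ℝ) (N : ℕ) (i : Fin d → ℤ) : Set (Euc d) :=
  {y | ∀ k, gx T N i k ≤ y k ∧ y k < gx T N i k + T / N ^ 2}

/-- The cube `v_j + [0, Δ_N^v)^d`. -/
def boxV (N : ℕ) (j : Fin d → ℤ) : Set (Euc d) :=
  {v | ∀ k, gv N j k ≤ v k ∧ v k < gv N j k + 1 / N}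

/-- The mass `m_i^x(μ) = μ(x_i + [0,Δ_N^x)^d)`. -/
def mxc (T : ℝ) (N : ℕ) (μ : Measure (Euc d)) (i : Fin d → ℤ) : ℝ≥0∞ := μ (boxX T N i)

/-- The mass `m_{ij}^v(W) = W({(x_i,v) : v ∈ v_j + [0,Δ_N^v)^d})`. -/
def mvc (T : ℝ) (N : ℕ) (W : Measure (Euc d × Euc d)) (i j : Fin d → ℤ) : ℝ≥0∞ :=
  W ({gxE T N i} ×ˢ boxV N j)

/-- The space discretization operator `𝒜_N^x`. -/
def Ax (T : ℝ) (N : ℕ) (μ : Measure (Euc d)) : Measure (Euc d) :=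
  Measure.sum fun i : Fin d → ℤ =>
    if okX T N i then mxc T N μ i • Measure.dirac (gxE T N i) else 0

/-- The Lattice Approximate Solution at grid times `kΔ_N`. -/
def LASk (T : ℝ) (N : ℕ) (V : Measure (Euc d) → Measure (Euc d × Euc d))
    (μ₀ : Measure (Euc d)) : ℕ → Measure (Euc d)
  | 0 => Ax T N μ₀
  | k + 1 =>
      Measure.sum fun ij : (Fin d → ℤ) × (Fin d → ℤ) =>
        if okX T N ij.1 ∧ okV T N ij.2 then
          mvc T N (V (LASk T N V μ₀ k)) ij.1 ij.2 •
            Measure.dirac (gxE T N ij.1 + (T / N) • gvE N ij.2)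
        else 0

/-- The (time-interpolated) Lattice Approximate Solution. -/
def LAS (T : ℝ) (N : ℕ) (V : Measure (Euc d) → Measure (Euc d × Euc d))
    (μ₀ : Measure (Euc d)) (t : ℝ) : Measure (Euc d) :=
  if t ≤ 0 then LASk T N V μ₀ 0
  else
    Measure.sum fun ij : (Fin d → ℤ) × (Fin d → ℤ) =>
      if okX T N ij.1 ∧ okV T N ij.2 then
        mvc T N (V (LASk T N V μ₀ (⌈t / (T / N)⌉.toNat - 1))) ij.1 ij.2 •
          Measure.dirac (gxE T N ij.1 +
            (t - (↑(⌈t / (T / N)⌉.toNat - 1) : ℝ) * (T / N)) • gvE N ij.2)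
      else 0

end LAS

section Curves

/-- The space of curves (with the product σ-algebra; the measures we consider are
concentrated on continuous curves). -/
abbrev Curve (d : ℕ) : Type := ℝ → Euc d

/-- Absolute continuity of a curve on `[a,b]`, via the integral representation. -/
def AbsCont {F : Type*} [NormedAddCommGroup F] [NormedSpace ℝ F] (a b : ℝ) (γ : ℝ → F) : Prop :=
  ∃ g : ℝ → F, IntervalIntegrable g volume a b ∧ ∀ t ∈ Icc a b, γ t = γ a + ∫ s in a..t, g s

/-- `κ` is a disintegration of `η` with respect to the evaluation map `e_s`. -/
def IsDisintAt {d : ℕ} (η : Measure (Curve d)) (s : ℝ) (κ : Euc d → Measure (Curve d)) : Prop :=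
  (∀ y, IsProbabilityMeasure (κ y)) ∧
  η.map (fun γ => (γ s, γ)) = (η.map fun γ => γ s).bind fun y => (κ y).map fun γ => (y, γ)

end Curves

section LASRep

variable {d : ℕ}

/-- The LAS characteristic curve `γ_{i,j}^ℓ(t) = x_i + (t - ℓΔ_N) v_j`. -/
def curveSeg (T : ℝ) (N : ℕ) (ℓ : ℕ) (i j : Fin d → ℤ) : Curve d :=
  fun t => gxE T N i + (t - (ℓ : ℝ) * (T / N)) • gvE N j

/-- The measure `η^N_{I_ℓ^{ℓ+1}} = Σ_{i,j} m_{ij}^v(V[μ^N_{ℓΔ_N}]) δ_{γ_{i,j}^ℓ}`. -/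
def ηseg (T : ℝ) (N : ℕ) (V : Measure (Euc d) → Measure (Euc d × Euc d))
    (μ₀ : Measure (Euc d)) (ℓ : ℕ) : Measure (Curve d) :=
  Measure.sum fun ij : (Fin d → ℤ) × (Fin d → ℤ) =>
    if okX T N ij.1 ∧ okV T N ij.2 then
      mvc T N (V (LASk T N V μ₀ ℓ)) ij.1 ij.2 • Measure.dirac (curveSeg T N ℓ ij.1 ij.2)
    else 0

/-- The merge (concatenation) of two compatible curves at time `s`. -/
def mergeAt {d : ℕ} (s : ℝ) (γ₁ γ₂ : Curve d) : Curve d := fun t => if t ≤ s then γ₁ t else γ₂ t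

/-- `ηN` is obtained from the LAS by the recursive concatenation construction
(Definition `def:reprLAS`): `η^N_{I_0^1}` is the measure concentrated on the LAS
characteristics on the first time interval and
`η^N_{I_0^{h+1}} = μ^N_{hΔ_N} ⊗ M♯(η^N_{I_0^h,x} ⊗ η^N_{I_h^{h+1},x})`,
where the fibered measures are disintegrations with respect to `e_{hΔ_N}`. -/
def IsLASRep (T : ℝ) (N : ℕ) (V : Measure (Euc d) → Measure (Euc d × Euc d))
    (μ₀ : Measure (Euc d)) (ηN : Measure (Curve d)) : Prop :=
  ∃ β : ℕ → Measure (Curve d), ∃ κ₀ κ₁ : ℕ → Euc d → Measure (Curve d),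
    β 1 = ηseg T N V μ₀ 0 ∧
    (∀ h : ℕ, 1 ≤ h → h ≤ N - 1 →
      IsDisintAt (β h) ((h : ℝ) * (T / N)) (κ₀ h) ∧
      IsDisintAt (ηseg T N V μ₀ h) ((h : ℝ) * (T / N)) (κ₁ h) ∧
      β (h + 1) =
        (LASk T N V μ₀ h).bind fun x =>
          ((κ₀ h x).prod (κ₁ h x)).map fun γγ => mergeAt ((h : ℝ) * (T / N)) γγ.1 γγ.2) ∧
    ηN = β N

end LASRep

/-- Continuity of a functional on curves with respect to uniform convergence on `[0,T]`
(the topology of `Γ_{[0,T]}`). -/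
def UnifCont {d : ℕ} (T : ℝ) (f : Curve d → ℝ) : Prop :=
  ∀ γ : Curve d, ∀ ε > 0, ∃ δ > 0, ∀ γ' : Curve d,
    (∀ t ∈ Icc (0 : ℝ) T, ‖γ' t - γ t‖ < δ) → |f γ' - f γ| < ε

/-- `μ` is concentrated on the possibly non-measurable set `S`: every measurable set disjoint
from `S` is `μ`-null. -/
def ConcentratedOn {X : Type*} [MeasurableSpace X] (S : Set X) (μ : Measure X) : Prop :=
  ∀ A : Set X, MeasurableSet A → Disjoint A S → μ A = 0

/-- The `L`-Lipschitz curves starting in the closed ball of radius `R`. -/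
def lipCurves (d : ℕ) (L : ℝ≥0) (R : ℝ) : Set (Curve d) :=
  {γ | LipschitzWith L γ ∧ ‖γ 0‖ ≤ R}

section PathSpace

variable {d : ℕ} {L : ℝ≥0} {R : ℝ}

lemma isCompact_lipCurves : IsCompact (lipCurves d L R) := by
  refine (isCompact_univ_pi
    (fun t : ℝ => isCompact_closedBall (0 : Euc d) (R + L * |t|))).of_isClosed_subset ?_ ?_
  · exact (isClosed_setOfPred_lipschitzWith L).inter
      (isClosed_le (continuous_apply (0 : ℝ)).norm continuous_const)
  · rintro γ ⟨hγ, h0⟩ t -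
    rw [mem_closedBall_zero_iff]
    have h := hγ.dist_le_mul t 0
    rw [dist_eq_norm, Real.dist_eq, sub_zero] at h
    have := norm_le_norm_add_norm_sub' (γ t) (γ 0)
    linarith

instance : CompactSpace (lipCurves d L R) := isCompact_iff_compactSpace.mp isCompact_lipCurves

/-- Restriction of a curve to the rational times. -/
def ratRestrict (d : ℕ) (γ : Curve d) : ℚ → Euc d := fun q => γ q

lemma measurable_ratRestrict : Measurable (ratRestrict d) := by
  unfold ratRestrict; fun_prop

lemma isClosedEmbedding_ratRestrict :
    IsClosedEmbedding fun γ : lipCurves d L R => ratRestrict d γ := by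
  refine Continuous.isClosedEmbedding ?_ ?_
  · exact continuous_pi fun q => (continuous_apply (q : ℝ)).comp continuous_subtype_val
  · intro γ γ' h
    refine Subtype.ext (Rat.denseRange_cast.equalizer γ.2.1.continuous γ'.2.1.continuous ?_)
    exact h

instance : TopologicalSpace.MetrizableSpace (lipCurves d L R) :=
  isClosedEmbedding_ratRestrict.isEmbedding.metrizableSpace

instance : BorelSpace (lipCurves d L R) := by
  refine ⟨le_antisymm ?_ ?_⟩
  · refine Measurable.comap_le (m₁ := borel (lipCurves d L R)) ?_
    refine @measurable_pi_lambda _ _ _ (borel (lipCurves d L R)) _ _ fun t => ?_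
    have h := ((continuous_apply t).comp continuous_subtype_val :
      Continuous fun γ : lipCurves d L R => γ.1 t).borel_measurable
    rwa [← BorelSpace.measurable_eq (α := Euc d)] at h
  · rw [isClosedEmbedding_ratRestrict.isInducing.eq_induced, borel_comap,
      ← BorelSpace.measurable_eq (α := ℚ → Euc d)]
    exact (measurable_ratRestrict.comp measurable_subtype_coe).comap_le

lemma exists_measurable_retraction [Nonempty (lipCurves d L R)] :
    ∃ r : Curve d → lipCurves d L R, Measurable r ∧ ∀ γ : lipCurves d L R, r γ = γ := by
  have hρ := (isClosedEmbedding_ratRestrict (d := d) (L := L) (R := R)).measurableEmbedding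
  refine ⟨hρ.invFun ∘ ratRestrict d, hρ.measurable_invFun.comp measurable_ratRestrict,
    fun γ => hρ.leftInverse_invFun γ⟩

lemma UnifCont.continuous_restrict {T : ℝ} {f : Curve d → ℝ} (hf : UnifCont T f) :
    Continuous fun γ : lipCurves d L R => f γ := by
  rw [continuous_iff_continuousAt]
  intro γ
  rw [ContinuousAt, Metric.tendsto_nhds]
  intro ε hε
  obtain ⟨δ, hδ, H⟩ := hf γ ε hε
  have hL : (0 : ℝ) < 3 * (L + 1) := by positivity
  obtain ⟨s, -, hs, hcov⟩ := (isCompact_Icc (a := (0 : ℝ)) (b := T)).finite_cover_balls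
    (e := δ / (3 * (L + 1))) (by positivity)
  have hev : ∀ᶠ γ' : lipCurves d L R in 𝓝 γ, ∀ t ∈ s, dist (γ'.1 t) (γ.1 t) < δ / 3 := by
    rw [hs.eventually_all]
    intro t _
    have hc : Continuous fun γ' : lipCurves d L R => γ'.1 t :=
      (continuous_apply t).comp continuous_subtype_val
    exact Metric.tendsto_nhds.mp (hc.tendsto γ) _ (by positivity)
  filter_upwards [hev] with γ' hγ'
  refine H γ'.1 fun t ht => ?_
  obtain ⟨u, hu, htu⟩ := mem_iUnion₂.mp (hcov ht)
  have hball : (L : ℝ) * dist t u ≤ δ / 3 := by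
    have h1 : dist t u ≤ δ / (3 * (L + 1)) := (mem_ball.mp htu).le
    rw [le_div_iff₀ hL] at h1
    nlinarith [dist_nonneg (x := t) (y := u)]
  have h1 := γ'.2.1.dist_le_mul t u
  have h2 := γ.2.1.dist_le_mul u t
  rw [dist_comm u t] at h2
  have h3 := hγ' u hu
  have h4 := dist_triangle4 (γ'.1 t) (γ'.1 u) (γ.1 u) (γ.1 t)
  rw [← dist_eq_norm]
  linarith

/-- Sequential compactness of families of laws of uniformly Lipschitz curves. -/
theorem exists_subseq_tendsto_of_concentratedOn_lipCurves (T : ℝ) (ν : ℕ → Measure (Curve d))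
    (hν : ∀ n, IsProbabilityMeasure (ν n))
    (hconc : ∀ n, ConcentratedOn (lipCurves d L R) (ν n)) :
    ∃ φ : ℕ → ℕ, StrictMono φ ∧ ∃ ν' : Measure (Curve d), IsProbabilityMeasure ν' ∧
      ∀ f : Curve d → ℝ, Measurable f → (∃ M, ∀ γ, |f γ| ≤ M) → UnifCont T f →
        Tendsto (fun k => ∫ γ, f γ ∂(ν (φ k))) atTop (𝓝 (∫ γ, f γ ∂ν')) := by
  have hne : Nonempty (lipCurves d L R) := by
    by_contra h
    have hempty : lipCurves d L R = ∅ := not_nonempty_iff_eq_empty.mp fun hn => h hn.to_subtype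
    have := hconc 0 univ MeasurableSet.univ (by simp [hempty])
    simp at this
  obtain ⟨r, hr, hrid⟩ := exists_measurable_retraction (d := d) (L := L) (R := R)
  let P : ℕ → ProbabilityMeasure (lipCurves d L R) := fun n =>
    ⟨(ν n).map r, Measure.isProbabilityMeasure_map hr.aemeasurable⟩
  obtain ⟨Q, φ, hφ, hlim⟩ := CompactSpace.tendsto_subseq P
  refine ⟨φ, hφ, (Q : Measure (lipCurves d L R)).map Subtype.val,
    Measure.isProbabilityMeasure_map measurable_subtype_coe.aemeasurable,
    fun f hfm ⟨M, hM⟩ hf => ?_⟩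
  have hlim' := (ProbabilityMeasure.tendsto_iff_forall_integral_tendsto.mp hlim)
    (BoundedContinuousFunction.ofNormedAddCommGroup (fun γ : lipCurves d L R => f γ)
      hf.continuous_restrict M fun γ => hM γ)
  simp only [BoundedContinuousFunction.coe_ofNormedAddCommGroup] at hlim'
  rw [integral_map measurable_subtype_coe.aemeasurable hfm.aestronglyMeasurable]
  convert hlim' using 2 with k
  have hsm : StronglyMeasurable fun γ : lipCurves d L R => f γ :=
    (hfm.comp measurable_subtype_coe).stronglyMeasurable
  change _ = ∫ γ : lipCurves d L R, f γ ∂((ν (φ k)).map r)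
  rw [integral_map hr.aemeasurable hsm.aestronglyMeasurable]
  refine integral_congr_ae ?_
  refine hconc (φ k) _ (measurableSet_eq_fun hfm (hfm.comp (measurable_subtype_coe.comp hr))).compl
    ?_
  rw [disjoint_compl_left_iff_subset]
  intro γ hγ
  have := hrid ⟨γ, hγ⟩
  simp [this]

end PathSpace

section ConcentratedOn

variable {X Y : Type*} [MeasurableSpace X] [MeasurableSpace Y]

lemma ConcentratedOn.map {S : Set X} {S' : Set Y} {μ : Measure X} (h : ConcentratedOn S μ)
    {g : X → Y} (hg : Measurable g) (hS : MapsTo g S S') : ConcentratedOn S' (μ.map g) := by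
  intro A hA hd
  rw [Measure.map_apply hg hA]
  exact h _ (hg hA) (disjoint_left.mpr fun x hx hxS => disjoint_left.mp hd hx (hS hxS))

lemma concentratedOn_map_of_ae {S : Set Y} {μ : Measure X} {g : X → Y} (hg : Measurable g)
    (h : ∀ᵐ x ∂μ, g x ∈ S) : ConcentratedOn S (μ.map g) := by
  intro A hA hd
  rw [Measure.map_apply hg hA]
  exact measure_mono_null (fun x hx hxS => disjoint_left.mp hd hx hxS) h

lemma ConcentratedOn.prod {S : Set X} {S' : Set Y} {μ : Measure X} {ν : Measure Y} [SFinite ν]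
    (hμ : ConcentratedOn S μ) (hν : ConcentratedOn S' ν) :
    ConcentratedOn (S ×ˢ S') (μ.prod ν) := by
  intro A hA hd
  rw [Measure.prod_apply hA, lintegral_eq_zero_iff (measurable_measure_prodMk_left hA)]
  refine hμ _ (measurableSet_eq_fun (measurable_measure_prodMk_left hA) measurable_const).compl ?_
  rw [disjoint_compl_left_iff_subset]
  intro x hx
  exact hν _ (measurable_prodMk_left hA)
    (disjoint_left.mpr fun y hy hyS => disjoint_left.mp hd hy ⟨hx, hyS⟩)

lemma ConcentratedOn.bind {S : Set Y} {m : Measure X} {κ : X → Measure Y} (hκ : AEMeasurable κ m)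
    (h : ∀ᵐ x ∂m, ConcentratedOn S (κ x)) : ConcentratedOn S (m.bind κ) := by
  intro A hA hd
  rw [Measure.bind_apply hA hκ, lintegral_eq_zero_iff' (by
    exact (Measure.measurable_coe hA).comp_aemeasurable hκ)]
  filter_upwards [h] with x hx using hx A hA hd

lemma ae_measure_singleton_ne_zero {m : Measure X} {G : Set X} (hG : G.Countable)
    (hm : ∀ᵐ x ∂m, x ∈ G) : ∀ᵐ x ∂m, m {x} ≠ 0 := by
  have hnull : m {x | x ∈ G ∧ m {x} = 0} = 0 := by
    have hc : {x | x ∈ G ∧ m {x} = 0}.Countable := hG.mono fun x hx => hx.1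
    rw [← biUnion_of_singleton {x | x ∈ G ∧ m {x} = 0}, measure_biUnion_null_iff hc]
    exact fun x hx => hx.2
  filter_upwards [hm, measure_eq_zero_iff_ae_notMem.mp hnull] with x hx hx' h0 using hx' ⟨hx, h0⟩

variable [MeasurableSingletonClass X]

lemma aemeasurable_of_ae_mem_countable {m : Measure X} {G : Set X} (hG : G.Countable)
    (hm : ∀ᵐ x ∂m, x ∈ G) [Nonempty Y] (g : X → Y) : AEMeasurable g m := by
  classical
  let c : Y := Classical.arbitrary Y
  refine ⟨fun x => if x ∈ G then g x else c,
    (measurable_const (a := c)).measurable_of_countable_ne (hG.mono fun x hx => ?_), ?_⟩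
  · by_contra hxG
    simp [hxG] at hx
  · filter_upwards [hm] with x hx
    simp [hx]

end ConcentratedOn

section Merge

variable {d : ℕ} {s : ℝ} {β η : Measure (Curve d)} {m : Measure (Euc d)} {G : Set (Euc d)}
  {κ κ₀ κ₁ : Euc d → Measure (Curve d)} {L : ℝ≥0} {R : ℝ}

lemma IsDisintAt.apply_prod (h : IsDisintAt η s κ) (hm : η.map (fun γ => γ s) = m)
    (hG : G.Countable) (hmG : ∀ᵐ x ∂m, x ∈ G) {B : Set (Euc d)} (hB : MeasurableSet B)
    {A : Set (Curve d)} (hA : MeasurableSet A) :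
    η ((fun γ => γ s) ⁻¹' B ∩ A) = ∫⁻ y in B, κ y A ∂m := by
  have hmeas : Measurable fun γ : Curve d => (γ s, γ) := by fun_prop
  have key := congrArg (fun μ : Measure (Euc d × Curve d) => μ (B ×ˢ A)) h.2
  simp only [hm] at key
  rw [Measure.map_apply hmeas (hB.prod hA), Measure.bind_apply (hB.prod hA)
    (aemeasurable_of_ae_mem_countable hG hmG _)] at key
  rw [← lintegral_indicator hB]
  refine key.trans (lintegral_congr fun y => ?_)
  rw [Measure.map_apply measurable_prodMk_left (hB.prod hA), mk_preimage_prod_right_eq_if]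
  by_cases hy : y ∈ B <;> simp [hy]

lemma IsDisintAt.eq_bind (h : IsDisintAt η s κ) (hm : η.map (fun γ => γ s) = m)
    (hG : G.Countable) (hmG : ∀ᵐ x ∂m, x ∈ G) : η = m.bind κ := by
  ext A hA
  rw [Measure.bind_apply hA (aemeasurable_of_ae_mem_countable hG hmG _)]
  simpa using h.apply_prod hm hG hmG MeasurableSet.univ hA

lemma IsDisintAt.ae_concentratedOn (h : IsDisintAt η s κ) (hm : η.map (fun γ => γ s) = m)
    (hG : G.Countable) (hmG : ∀ᵐ x ∂m, x ∈ G) {S : Set (Curve d)} (hS : ConcentratedOn S η) :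
    ∀ᵐ x ∂m, ConcentratedOn (S ∩ {γ | γ s = x}) (κ x) := by
  filter_upwards [ae_measure_singleton_ne_zero hG hmG] with x hx A hA hd
  have hs : MeasurableSet ((fun γ : Curve d => γ s) ⁻¹' {x}) :=
    measurable_pi_apply s (measurableSet_singleton x)
  have h0 := h.apply_prod hm hG hmG (measurableSet_singleton x) hA
  rw [hS _ (hs.inter hA) (disjoint_left.mpr fun γ hγ hγS =>
    disjoint_left.mp hd hγ.2 ⟨hγS, hγ.1⟩), lintegral_singleton] at h0
  exact (mul_eq_zero.mp h0.symm).resolve_right hx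

lemma measurable_mergeAt (s : ℝ) :
    Measurable fun γγ : Curve d × Curve d => mergeAt s γγ.1 γγ.2 := by
  refine measurable_pi_lambda _ fun t => ?_
  unfold mergeAt
  split_ifs <;> fun_prop

lemma mergeAt_mem_lipCurves (hs : 0 ≤ s) {γ₁ γ₂ : Curve d} (h₁ : γ₁ ∈ lipCurves d L R)
    (h₂ : γ₂ ∈ lipCurves d L R) (h : γ₁ s = γ₂ s) : mergeAt s γ₁ γ₂ ∈ lipCurves d L R := by
  refine ⟨?_, by simpa [mergeAt, hs] using h₁.2⟩
  have key : ∀ t u, t ≤ u → dist (mergeAt s γ₁ γ₂ t) (mergeAt s γ₁ γ₂ u) ≤ L * dist t u := by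
    intro t u htu
    by_cases ht : t ≤ s <;> by_cases hu : u ≤ s
    · simpa [mergeAt, ht, hu] using h₁.1.dist_le_mul t u
    · simp only [mergeAt, ht, hu, if_true, if_false]
      have h3 := dist_triangle (γ₁ t) (γ₁ s) (γ₂ u)
      have h4 := h₁.1.dist_le_mul t s
      have h5 := h₂.1.dist_le_mul s u
      rw [← h] at h5
      rw [Real.dist_eq, abs_of_nonpos (by linarith)] at h4 h5 ⊢
      linarith
    · exact absurd (htu.trans hu) ht
    · simpa [mergeAt, ht, hu] using h₂.1.dist_le_mul t u
  refine LipschitzWith.of_dist_le_mul fun t u => ?_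
  rcases le_total t u with htu | htu
  · exact key t u htu
  · rw [dist_comm, dist_comm t u]
    exact key u t htu

lemma bind_merge_map_eval (h₀ : IsDisintAt β s κ₀) (hβ : β.map (fun γ => γ s) = m)
    (h₁ : IsDisintAt η s κ₁) (hη : η.map (fun γ => γ s) = m)
    (hG : G.Countable) (hmG : ∀ᵐ x ∂m, x ∈ G) (t : ℝ) :
    (m.bind fun x => ((κ₀ x).prod (κ₁ x)).map fun γγ => mergeAt s γγ.1 γγ.2).map (fun γ => γ t) =
      if t ≤ s then β.map (fun γ => γ t) else η.map (fun γ => γ t) := by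
  ext B hB
  have ht : Measurable fun γ : Curve d => γ t := measurable_pi_apply t
  rw [Measure.map_apply ht hB, Measure.bind_apply (ht hB)
    (aemeasurable_of_ae_mem_countable hG hmG _)]
  have hP₀ := h₀.1
  have hP₁ := h₁.1
  split_ifs with hts
  · rw [Measure.map_apply ht hB, h₀.eq_bind hβ hG hmG, Measure.bind_apply (ht hB)
      (aemeasurable_of_ae_mem_countable hG hmG _)]
    refine lintegral_congr fun x => ?_
    rw [Measure.map_apply (measurable_mergeAt s) (ht hB)]
    have : (fun γγ : Curve d × Curve d => mergeAt s γγ.1 γγ.2) ⁻¹' ((fun γ => γ t) ⁻¹' B) =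
        ((fun γ => γ t) ⁻¹' B) ×ˢ univ := by
      ext; simp [mergeAt, hts]
    rw [this, Measure.prod_prod, measure_univ, mul_one]
  · rw [Measure.map_apply ht hB, h₁.eq_bind hη hG hmG, Measure.bind_apply (ht hB)
      (aemeasurable_of_ae_mem_countable hG hmG _)]
    refine lintegral_congr fun x => ?_
    rw [Measure.map_apply (measurable_mergeAt s) (ht hB)]
    have : (fun γγ : Curve d × Curve d => mergeAt s γγ.1 γγ.2) ⁻¹' ((fun γ => γ t) ⁻¹' B) =
        univ ×ˢ ((fun γ => γ t) ⁻¹' B) := by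
      ext; simp [mergeAt, hts]
    rw [this, Measure.prod_prod, measure_univ, one_mul]

lemma concentratedOn_bind_merge (hs : 0 ≤ s) (h₀ : IsDisintAt β s κ₀)
    (hβ : β.map (fun γ => γ s) = m) (h₁ : IsDisintAt η s κ₁) (hη : η.map (fun γ => γ s) = m)
    (hG : G.Countable) (hmG : ∀ᵐ x ∂m, x ∈ G) (hβS : ConcentratedOn (lipCurves d L R) β)
    (hηS : ConcentratedOn (lipCurves d L R) η) :
    ConcentratedOn (lipCurves d L R)
      (m.bind fun x => ((κ₀ x).prod (κ₁ x)).map fun γγ => mergeAt s γγ.1 γγ.2) := by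
  refine ConcentratedOn.bind (aemeasurable_of_ae_mem_countable hG hmG _) ?_
  filter_upwards [h₀.ae_concentratedOn hβ hG hmG hβS, h₁.ae_concentratedOn hη hG hmG hηS]
    with x hx₀ hx₁
  have hP₁ := h₁.1
  refine (hx₀.prod hx₁).map (measurable_mergeAt s) ?_
  rintro ⟨γ₁, γ₂⟩ ⟨⟨h₁S, h₁x⟩, h₂S, h₂x⟩
  exact mergeAt_mem_lipCurves hs h₁S h₂S (h₁x.trans h₂x.symm)

end Merge

section Lattice

variable {d : ℕ} {T : ℝ} {N : ℕ}

/-- The index of the lattice cell of side `δ` containing `x`. -/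
def cellIdx (δ : ℝ) (x : Euc d) : Fin d → ℤ := fun k => ⌊x k / δ⌋

lemma measurable_cellIdx (δ : ℝ) : Measurable (cellIdx δ : Euc d → Fin d → ℤ) := by
  unfold cellIdx
  fun_prop

lemma cellIdx_eq_iff {δ : ℝ} (hδ : 0 < δ) {x : Euc d} {i : Fin d → ℤ} :
    cellIdx δ x = i ↔ ∀ k, δ * i k ≤ x k ∧ x k < δ * i k + δ := by
  rw [funext_iff]
  refine forall_congr' fun k => ?_
  rw [cellIdx, Int.floor_eq_iff, le_div_iff₀ hδ, div_lt_iff₀ hδ]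
  constructor <;> rintro ⟨h₁, h₂⟩ <;> constructor <;> linarith

lemma mem_boxX_iff (hT : 0 < T) (hN : 0 < N) {x : Euc d} {i : Fin d → ℤ} :
    x ∈ boxX T N i ↔ cellIdx (T / N ^ 2) x = i := by
  rw [cellIdx_eq_iff (by positivity)]; rfl

lemma mem_boxV_iff (hN : 0 < N) {v : Euc d} {j : Fin d → ℤ} :
    v ∈ boxV N j ↔ cellIdx (1 / N) v = j := by
  rw [cellIdx_eq_iff (by positivity)]; rfl

lemma gxE_apply (i : Fin d → ℤ) (k : Fin d) : gxE T N i k = T / N ^ 2 * i k := rfl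

lemma gvE_apply (j : Fin d → ℤ) (k : Fin d) : gvE N j k = 1 / N * j k := rfl

lemma cellIdx_gxE (hT : 0 < T) (hN : 0 < N) (i : Fin d → ℤ) :
    cellIdx (T / N ^ 2) (gxE T N i) = i := by
  have hδ : 0 < T / (N : ℝ) ^ 2 := by positivity
  rw [cellIdx_eq_iff hδ]
  intro k
  rw [gxE_apply]
  exact ⟨le_rfl, by linarith⟩

lemma gxE_add_smul_gvE (i j : Fin d → ℤ) :
    gxE T N i + (T / N) • gvE N j = gxE T N (i + j) := by
  ext k
  simp only [PiLp.add_apply, PiLp.smul_apply, gxE_apply, gvE_apply, smul_eq_mul, Pi.add_apply,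
    Int.cast_add]
  ring

lemma norm_le_sqrt_mul_of_forall_abs_le {δ : ℝ} (hδ : 0 ≤ δ) {x : Euc d} (h : ∀ k, |x k| ≤ δ) :
    ‖x‖ ≤ √d * δ := by
  rw [EuclideanSpace.norm_eq, Real.sqrt_le_left (by positivity), mul_pow,
    Real.sq_sqrt (by positivity)]
  calc ∑ k, ‖x k‖ ^ 2 ≤ ∑ _k : Fin d, δ ^ 2 := by
        gcongr with k
        exact h k
    _ = d * δ ^ 2 := by simp

lemma norm_gxE_cellIdx_le (hT : 0 < T) (hN : 0 < N) (x : Euc d) :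
    ‖gxE T N (cellIdx (T / N ^ 2) x)‖ ≤ ‖x‖ + √d * (T / N ^ 2) := by
  have hδ : 0 < T / (N : ℝ) ^ 2 := by positivity
  have h := (cellIdx_eq_iff hδ (x := x)).mp rfl
  have h2 : ‖gxE T N (cellIdx (T / N ^ 2) x) - x‖ ≤ √d * (T / N ^ 2) := by
    refine norm_le_sqrt_mul_of_forall_abs_le hδ.le fun k => ?_
    rw [PiLp.sub_apply, gxE_apply, abs_le]
    constructor <;> linarith [(h k).1, (h k).2]
  linarith [norm_le_norm_add_norm_sub' (gxE T N (cellIdx (T / N ^ 2) x)) x]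

lemma norm_gvE_cellIdx_le (hN : 0 < N) (v : Euc d) :
    ‖gvE N (cellIdx (1 / N) v)‖ ≤ ‖v‖ + √d * (1 / N) := by
  have hδ : 0 < 1 / (N : ℝ) := by positivity
  have h := (cellIdx_eq_iff hδ (x := v)).mp rfl
  have h2 : ‖gvE N (cellIdx (1 / N) v) - v‖ ≤ √d * (1 / N) := by
    refine norm_le_sqrt_mul_of_forall_abs_le hδ.le fun k => ?_
    rw [PiLp.sub_apply, gvE_apply, abs_le]
    constructor <;> linarith [(h k).1, (h k).2]
  linarith [norm_le_norm_add_norm_sub' (gvE N (cellIdx (1 / N) v)) v]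

lemma okX_of_norm_le {i : Fin d → ℤ} (h : ‖gxE T N i‖ ≤ N) : okX T N i :=
  fun k => (PiLp.norm_apply_le (gxE T N i) k).trans h

lemma okV_of_norm_le {j : Fin d → ℤ} (h : ‖gvE N j‖ ≤ T * N) : okV T N j :=
  fun k => (PiLp.norm_apply_le (gvE N j) k).trans h

lemma map_eq_sum_dirac {X I Y : Type*} [MeasurableSpace X] [MeasurableSpace I] [MeasurableSpace Y]
    [Countable I] [MeasurableSingletonClass I] (W : Measure X) {J : X → I} (hJ : Measurable J)
    (F : I → Y) :
    W.map (fun x => F (J x)) = Measure.sum fun i => W (J ⁻¹' {i}) • Measure.dirac (F i) := by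
  have hF : Measurable F := measurable_of_countable F
  have h : W.map (fun x => F (J x)) = (W.map J).map F := (Measure.map_map hF hJ).symm
  rw [h]
  ext A hA
  rw [Measure.map_apply hF hA, ← Measure.sum_smul_dirac (W.map J), Measure.sum_apply _ (hF hA),
    Measure.sum_apply _ hA]
  refine tsum_congr fun i => ?_
  simp only [Measure.smul_apply, Measure.dirac_apply' _ (hF hA), Measure.dirac_apply' _ hA]
  rw [Measure.map_apply hJ (measurableSet_singleton i)]
  rfl

/-- The pair of indices of the space and velocity cells containing a point of `Tℝ^d`. -/
def cellIdx₂ (T : ℝ) (N : ℕ) (p : Euc d × Euc d) : (Fin d → ℤ) × (Fin d → ℤ) :=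
  (cellIdx (T / N ^ 2) p.1, cellIdx (1 / N) p.2)

lemma measurable_cellIdx₂ : Measurable (cellIdx₂ T N : Euc d × Euc d → _) :=
  ((measurable_cellIdx _).comp measurable_fst).prodMk ((measurable_cellIdx _).comp measurable_snd)

lemma sum_mvc_eq_map {Y : Type*} [MeasurableSpace Y] (hT : 0 < T) (hN : 0 < N)
    {W : Measure (Euc d × Euc d)} (hgrid : ∀ᵐ p ∂W, p.1 ∈ range (gxE T N))
    (hok : ∀ᵐ p ∂W, okX T N (cellIdx₂ T N p).1 ∧ okV T N (cellIdx₂ T N p).2)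
    (F : (Fin d → ℤ) × (Fin d → ℤ) → Y) :
    (Measure.sum fun ij : (Fin d → ℤ) × (Fin d → ℤ) =>
      if okX T N ij.1 ∧ okV T N ij.2 then mvc T N W ij.1 ij.2 • Measure.dirac (F ij) else 0) =
      W.map fun p => F (cellIdx₂ T N p) := by
  rw [map_eq_sum_dirac W measurable_cellIdx₂ F]
  congr 1
  funext ⟨i, j⟩
  split_ifs with h
  · congr 1
    refine measure_congr ?_
    filter_upwards [hgrid] with p ⟨i', hi'⟩
    refine propext ?_
    change (p.1 = gxE T N i ∧ p.2 ∈ boxV N j) ↔ (cellIdx _ p.1, cellIdx _ p.2) = (i, j)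
    rw [mem_boxV_iff hN, Prod.mk.injEq, ← hi', cellIdx_gxE hT hN]
    refine and_congr_left fun _ => ⟨fun h => ?_, fun h => h ▸ rfl⟩
    rw [← cellIdx_gxE hT hN i', h, cellIdx_gxE hT hN]
  · have h0 : W (cellIdx₂ T N ⁻¹' {(i, j)}) = 0 := by
      rw [measure_eq_zero_iff_ae_notMem]
      filter_upwards [hok] with p hpok hp
      rw [mem_preimage, mem_singleton_iff] at hp
      exact h (by simpa [hp] using hpok)
    rw [h0, zero_smul]

lemma Ax_eq_map (hT : 0 < T) (hN : 0 < N) {ν : Measure (Euc d)}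
    (hok : ∀ᵐ x ∂ν, okX T N (cellIdx (T / N ^ 2) x)) :
    Ax T N ν = ν.map fun x => gxE T N (cellIdx (T / N ^ 2) x) := by
  rw [map_eq_sum_dirac ν (measurable_cellIdx _) (gxE T N), Ax]
  congr 1
  funext i
  have hbox : boxX T N i = cellIdx (T / N ^ 2) ⁻¹' {i} := by
    ext x
    exact mem_boxX_iff hT hN
  split_ifs with h
  · rw [mxc, hbox]
  · have h0 : ν (cellIdx (T / N ^ 2) ⁻¹' {i}) = 0 := by
      rw [measure_eq_zero_iff_ae_notMem]
      filter_upwards [hok] with x hxok hx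
      rw [mem_preimage, mem_singleton_iff] at hx
      exact h (by simpa [hx] using hxok)
    rw [h0, zero_smul]

end Lattice

section Support

lemma ae_mem_msupp {X : Type*} [TopologicalSpace X] [MeasurableSpace X]
    [SecondCountableTopology X] (μ : Measure X) : ∀ᵐ x ∂μ, x ∈ msupp μ := by
  refine measure_null_of_locally_null _ fun x hx => ?_
  have hx' : ¬ ∀ U : Set X, IsOpen U → x ∈ U → 0 < μ U := hx
  push Not at hx'
  obtain ⟨U, hU, hxU, h0⟩ := hx'
  exact ⟨U, mem_nhdsWithin_of_mem_nhds (hU.mem_nhds hxU), nonpos_iff_eq_zero.mp h0⟩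

variable {d : ℕ} {V : Measure (Euc d) → Measure (Euc d × Euc d)} {m : Measure (Euc d)} {C r : ℝ}

lemma Pc_of_ae_norm_le [IsProbabilityMeasure m] (h : ∀ᵐ x ∂m, ‖x‖ ≤ r) : Pc m := by
  refine ⟨inferInstance, closedBall 0 r, isCompact_closedBall 0 r, ?_⟩
  rw [measure_eq_zero_iff_ae_notMem]
  filter_upwards [h] with x hx hx' using hx' (mem_closedBall_zero_iff.mpr hx)

lemma Pc.exists_ae_norm_le (h : Pc m) : ∃ r : ℝ, 0 ≤ r ∧ ∀ᵐ x ∂m, ‖x‖ ≤ r := by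
  obtain ⟨-, K, hK, h0⟩ := h
  obtain ⟨r, hr⟩ := hK.isBounded.exists_norm_le
  refine ⟨max r 0, le_max_right _ _, ?_⟩
  filter_upwards [measure_eq_zero_iff_ae_notMem.mp h0] with x hx
  exact (hr x (not_notMem.mp hx)).trans (le_max_left _ _)

lemma H1cond.ae_norm_snd_le (hV : H1cond C V) (hC : 0 ≤ C) [IsProbabilityMeasure m]
    (hr : 0 ≤ r) (h : ∀ᵐ x ∂m, ‖x‖ ≤ r) : ∀ᵐ p ∂(V m), ‖p.2‖ ≤ C * (1 + r) := by
  filter_upwards [ae_mem_msupp (V m)] with p hp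
  refine (hV m (Pc_of_ae_norm_le h) p hp).trans ?_
  gcongr
  refine Real.iSup_le (fun x => ?_) hr
  by_contra! hx
  have hpos := x.2 {y | r < ‖y‖} (isOpen_lt continuous_const continuous_norm) hx
  refine hpos.ne' (measure_eq_zero_iff_ae_notMem.mpr ?_)
  filter_upwards [h] with y hy using not_lt.mpr hy

end Support

section Bounds

variable {d : ℕ} {T : ℝ} {N : ℕ} {V : Measure (Euc d) → Measure (Euc d × Euc d)}
  {m : Measure (Euc d)} {C : ℝ}

/-- `W` is a velocity measure over the probability measure `m` that is supported on the space
lattice, stays inside the window of the lattice discretization, has positions bounded by `R` and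
discretized velocities bounded by `L`. -/
structure LatticeStep (T : ℝ) (N : ℕ) (W : Measure (Euc d × Euc d)) (m : Measure (Euc d))
    (R L : ℝ) : Prop where
  isProbabilityMeasure : IsProbabilityMeasure m
  map_fst : W.map Prod.fst = m
  ae_grid : ∀ᵐ p ∂W, p.1 ∈ range (gxE T N)
  ae_ok : ∀ᵐ p ∂W, okX T N (cellIdx₂ T N p).1 ∧ okV T N (cellIdx₂ T N p).2
  ae_norm_fst : ∀ᵐ p ∂W, ‖p.1‖ ≤ R
  ae_norm_velocity : ∀ᵐ p ∂W, ‖gvE N (cellIdx₂ T N p).2‖ ≤ L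

lemma gxE_cellIdx_of_mem_range (hT : 0 < T) (hN : 0 < N) {x : Euc d}
    (hx : x ∈ range (gxE T N)) : gxE T N (cellIdx (T / N ^ 2) x) = x := by
  obtain ⟨i, rfl⟩ := hx
  rw [cellIdx_gxE hT hN]

lemma LatticeStep.of_ae_norm_le {a : ℝ} (hT : 0 < T) (hN : 0 < N) (hV : IsPVF V)
    (hC : H1cond C V) (hC0 : 0 ≤ C) [hm : IsProbabilityMeasure m] (ha : 0 ≤ a)
    (hgrid : ∀ᵐ x ∂m, x ∈ range (gxE T N)) (hnorm : ∀ᵐ x ∂m, ‖x‖ ≤ a)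
    (haN : a ≤ N) (hLN : (C + √d) * (1 + a) ≤ T * N) :
    LatticeStep T N (V m) m a ((C + √d) * (1 + a)) := by
  have hfst : (V m).map Prod.fst = m := (hV m hm).2
  have hlift : ∀ {q : Euc d → Prop}, (∀ᵐ x ∂m, q x) → ∀ᵐ p ∂(V m), q p.1 := fun h =>
    ae_of_ae_map measurable_fst.aemeasurable (by rwa [hfst])
  have hvel : ∀ᵐ p ∂(V m), ‖gvE N (cellIdx₂ T N p).2‖ ≤ (C + √d) * (1 + a) := by
    filter_upwards [hC.ae_norm_snd_le hC0 ha hnorm] with p hp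
    have h1 := norm_gvE_cellIdx_le hN p.2
    have h2 : √d * (1 / (N : ℝ)) ≤ √d * (1 + a) := by
      have : (1 : ℝ) / N ≤ 1 := by
        rw [div_le_one (by positivity)]
        exact_mod_cast hN
      gcongr
      linarith
    change ‖gvE N (cellIdx (1 / N) p.2)‖ ≤ _
    linarith
  refine ⟨hm, hfst, hlift hgrid, ?_, hlift hnorm, hvel⟩
  filter_upwards [hlift hgrid, hlift hnorm, hvel] with p h1 h2 h3
  refine ⟨okX_of_norm_le ?_, okV_of_norm_le (h3.trans hLN)⟩
  change ‖gxE T N (cellIdx (T / N ^ 2) p.1)‖ ≤ N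
  rw [gxE_cellIdx_of_mem_range hT hN h1]
  exact h2.trans haN

lemma LatticeStep.mono {W : Measure (Euc d × Euc d)} {R L R' L' : ℝ}
    (h : LatticeStep T N W m R L) (hR : R ≤ R') (hL : L ≤ L') : LatticeStep T N W m R' L' :=
  { h with
    ae_norm_fst := h.ae_norm_fst.mono fun _ hp => hp.trans hR
    ae_norm_velocity := h.ae_norm_velocity.mono fun _ hp => hp.trans hL }

lemma LatticeStep.isProbabilityMeasure_velocity {W : Measure (Euc d × Euc d)} {R L : ℝ}
    (h : LatticeStep T N W m R L) : IsProbabilityMeasure W := by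
  have := h.isProbabilityMeasure
  have h1 := h.map_fst
  refine ⟨?_⟩
  rw [← measure_univ (μ := m), ← h1, Measure.map_apply measurable_fst MeasurableSet.univ,
    preimage_univ]

/-- The a priori bound on the support of the lattice scheme after `h` steps. -/
def stepRadius (r A T : ℝ) (N h : ℕ) : ℝ := (1 + r) * (1 + A * (T / N)) ^ h - 1

lemma stepRadius_succ (r A T : ℝ) (N h : ℕ) :
    stepRadius r A T N (h + 1) =
      stepRadius r A T N h + T / N * (A * (1 + stepRadius r A T N h)) := by
  unfold stepRadius; ring

lemma le_stepRadius {r A : ℝ} (hr : 0 ≤ r) (hA : 0 ≤ A) (hT : 0 ≤ T) (h : ℕ) :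
    r ≤ stepRadius r A T N h := by
  unfold stepRadius
  have : 1 ≤ (1 + A * (T / N)) ^ h := one_le_pow₀ (by linarith [show 0 ≤ A * (T / N) by positivity])
  nlinarith

lemma stepRadius_le {r A : ℝ} (hr : 0 ≤ r) (hA : 0 ≤ A) (hT : 0 ≤ T) (hN : 0 < N) {h : ℕ}
    (hh : h ≤ N) : stepRadius r A T N h ≤ (1 + r) * Real.exp (A * T) - 1 := by
  unfold stepRadius
  have h1 : 1 ≤ 1 + A * (T / N) := by linarith [show 0 ≤ A * (T / N) by positivity]
  have h2 : (1 + A * (T / N)) ^ h ≤ Real.exp (A * T) := by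
    calc (1 + A * (T / N)) ^ h ≤ (1 + A * (T / N)) ^ N := pow_le_pow_right₀ h1 hh
      _ ≤ (Real.exp (A * (T / N))) ^ N := by
        gcongr
        linarith [Real.add_one_le_exp (A * (T / N))]
      _ = Real.exp (A * T) := by
        rw [← Real.exp_nat_mul]
        congr 1
        field_simp
  gcongr

lemma LASk_succ_eq_map (hT : 0 < T) (hN : 0 < N) {μ₀ : Measure (Euc d)} {h : ℕ} {R L : ℝ}
    (hstep : LatticeStep T N (V (LASk T N V μ₀ h)) m R L) :
    LASk T N V μ₀ (h + 1) = (V (LASk T N V μ₀ h)).map fun p =>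
      gxE T N (cellIdx₂ T N p).1 + (T / N) • gvE N (cellIdx₂ T N p).2 :=
  sum_mvc_eq_map hT hN hstep.ae_grid hstep.ae_ok
    fun ij => gxE T N ij.1 + (T / N) • gvE N ij.2

lemma LASk_support (hT : 0 < T) (hN : 0 < N) (hV : IsPVF V) (hC : H1cond C V) (hC0 : 0 ≤ C)
    {μ₀ : Measure (Euc d)} [IsProbabilityMeasure μ₀] {r : ℝ} (hr : 0 ≤ r)
    (hμ₀ : ∀ᵐ x ∂μ₀, ‖x‖ + √d * T ≤ r)
    {R : ℝ} (hR : (1 + r) * Real.exp ((C + √d) * T) - 1 = R) (hRN : R ≤ N)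
    (hLN : (C + √d) * (1 + R) ≤ T * N) :
    ∀ h ≤ N, IsProbabilityMeasure (LASk T N V μ₀ h) ∧
      (∀ᵐ x ∂(LASk T N V μ₀ h), x ∈ range (gxE T N)) ∧
      ∀ᵐ x ∂(LASk T N V μ₀ h), ‖x‖ ≤ stepRadius r (C + √d) T N h := by
  have hA : 0 ≤ C + √d := by positivity
  have hle : ∀ h ≤ N, stepRadius r (C + √d) T N h ≤ R := fun h hh =>
    hR ▸ stepRadius_le hr hA hT.le hN hh
  have hmap : ∀ {X : Type} [MeasurableSpace X] {ν : Measure X} {g : X → Euc d},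
      Measurable g → ∀ {q : Euc d → Prop}, MeasurableSet {x | q x} → (∀ᵐ p ∂ν, q (g p)) →
      ∀ᵐ x ∂(ν.map g), q x := fun hg _ hq h => (ae_map_iff hg.aemeasurable hq).mpr h
  have hgm : MeasurableSet {x : Euc d | x ∈ range (gxE T N)} :=
    (countable_range (gxE T N)).measurableSet
  have hnm : ∀ a : ℝ, MeasurableSet {x : Euc d | ‖x‖ ≤ a} := fun a =>
    measurableSet_le measurable_norm measurable_const
  intro h
  induction h with
  | zero =>
    intro _
    have hnorm : ∀ᵐ x ∂μ₀, ‖gxE T N (cellIdx (T / N ^ 2) x)‖ ≤ r := by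
      filter_upwards [hμ₀] with x hx
      refine (norm_gxE_cellIdx_le hT hN x).trans (le_trans ?_ hx)
      gcongr
      refine div_le_self hT.le (one_le_pow₀ ?_)
      exact_mod_cast hN
    have hrR : r ≤ R := (le_stepRadius hr hA hT.le 0).trans (hle 0 (Nat.zero_le _))
    have hmeas : Measurable fun x : Euc d => gxE T N (cellIdx (T / N ^ 2) x) :=
      (measurable_of_countable (gxE T N)).comp (measurable_cellIdx _)
    have heq : LASk T N V μ₀ 0 = μ₀.map fun x => gxE T N (cellIdx (T / N ^ 2) x) :=
      Ax_eq_map hT hN (hnorm.mono fun x hx => okX_of_norm_le (hx.trans (hrR.trans hRN)))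
    rw [heq]
    refine ⟨Measure.isProbabilityMeasure_map hmeas.aemeasurable,
      hmap hmeas hgm (ae_of_all _ fun x => mem_range_self _), hmap hmeas (hnm _) ?_⟩
    simpa [stepRadius] using hnorm
  | succ h ih =>
    intro hh
    obtain ⟨hP, hgrid, hnorm⟩ := ih (by lia)
    have haR := hle h (by lia)
    have hstep := LatticeStep.of_ae_norm_le hT hN hV hC hC0
      (hr.trans (le_stepRadius hr hA hT.le h)) hgrid hnorm (haR.trans hRN)
      (le_trans (by gcongr) hLN)
    have hPW := hstep.isProbabilityMeasure_velocity
    have hmeas : Measurable fun p : Euc d × Euc d =>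
        gxE T N (cellIdx₂ T N p).1 + (T / N) • gvE N (cellIdx₂ T N p).2 :=
      (measurable_of_countable fun ij : (Fin d → ℤ) × (Fin d → ℤ) =>
        gxE T N ij.1 + (T / N) • gvE N ij.2).comp measurable_cellIdx₂
    rw [LASk_succ_eq_map hT hN hstep]
    refine ⟨Measure.isProbabilityMeasure_map hmeas.aemeasurable,
      hmap hmeas hgm (ae_of_all _ fun p => ?_), hmap hmeas (hnm _) ?_⟩
    · rw [gxE_add_smul_gvE]
      exact mem_range_self _
    · filter_upwards [hstep.ae_grid, hstep.ae_norm_fst, hstep.ae_norm_velocity] with p h1 h2 h3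
      refine (norm_add_le _ _).trans ?_
      rw [stepRadius_succ, norm_smul, Real.norm_of_nonneg (by positivity)]
      have h4 : gxE T N (cellIdx₂ T N p).1 = p.1 := gxE_cellIdx_of_mem_range hT hN h1
      rw [h4]
      gcongr

theorem exists_latticeStep_LASk (hT : 0 < T) (hV : IsPVF V) (h1 : H1 V) {μ₀ : Measure (Euc d)}
    (hμ₀ : Pc μ₀) :
    ∃ (R : ℝ) (L : ℝ≥0) (N₀ : ℕ), 1 ≤ N₀ ∧ ∀ N ≥ N₀, ∀ h ≤ N,
      LatticeStep T N (V (LASk T N V μ₀ h)) (LASk T N V μ₀ h) R L := by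
  obtain ⟨C, hC0, hC⟩ := h1
  obtain ⟨r₀, hr₀, hsupp⟩ := hμ₀.exists_ae_norm_le
  have := hμ₀.1
  have hA : 0 ≤ C + √d := by positivity
  have hr : 0 ≤ r₀ + √d * T := by positivity
  set r := r₀ + √d * T
  set R := (1 + r) * Real.exp ((C + √d) * T) - 1 with hRdef
  have hR : 0 ≤ R := by
    have : 1 ≤ Real.exp ((C + √d) * T) := Real.one_le_exp (by positivity)
    rw [hRdef]
    nlinarith
  have hL : 0 ≤ (C + √d) * (1 + R) := by positivity
  obtain ⟨N₁, hN₁⟩ := exists_nat_ge (max R ((C + √d) * (1 + R) / T))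
  refine ⟨R, ⟨(C + √d) * (1 + R), hL⟩, max N₁ 1, le_max_right _ _, fun N hN h hh => ?_⟩
  have hN0 : 0 < N := lt_of_lt_of_le one_pos ((le_max_right _ _).trans hN)
  have hN1 : max R ((C + √d) * (1 + R) / T) ≤ N :=
    hN₁.trans (by exact_mod_cast (le_max_left _ _).trans hN)
  have hRN : R ≤ N := (le_max_left _ _).trans hN1
  have hLN : (C + √d) * (1 + R) ≤ T * N := by
    rw [mul_comm T, ← div_le_iff₀ hT]
    exact (le_max_right _ _).trans hN1
  obtain ⟨hP, hgrid, hnorm⟩ := LASk_support hT hN0 hV hC hC0.le hr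
    (hsupp.mono fun x hx => by simpa [r] using hx) hRdef.symm hRN hLN h hh
  have haR : stepRadius r (C + √d) T N h ≤ R := stepRadius_le hr hA hT.le hN0 hh
  refine (LatticeStep.of_ae_norm_le hT hN0 hV hC hC0.le
    (hr.trans (le_stepRadius hr hA hT.le h)) hgrid hnorm (haR.trans hRN)
    (le_trans (by gcongr) hLN)).mono haR ?_
  change _ ≤ (C + √d) * (1 + R)
  gcongr

end Bounds

section Representation

variable {d : ℕ} {T : ℝ} {N : ℕ} {V : Measure (Euc d) → Measure (Euc d × Euc d)}
  {μ₀ : Measure (Euc d)} {h : ℕ} {R : ℝ} {L : ℝ≥0}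

lemma measurable_curveSeg_cellIdx₂ (T : ℝ) (N h : ℕ) :
    Measurable fun p : Euc d × Euc d =>
      curveSeg T N h (cellIdx₂ T N p).1 (cellIdx₂ T N p).2 :=
  (measurable_of_countable fun ij : (Fin d → ℤ) × (Fin d → ℤ) =>
    curveSeg T N h ij.1 ij.2).comp measurable_cellIdx₂

lemma ηseg_eq_map (hT : 0 < T) (hN : 0 < N) {m : Measure (Euc d)}
    (hstep : LatticeStep T N (V (LASk T N V μ₀ h)) m R L) :
    ηseg T N V μ₀ h = (V (LASk T N V μ₀ h)).map fun p =>
      curveSeg T N h (cellIdx₂ T N p).1 (cellIdx₂ T N p).2 :=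
  sum_mvc_eq_map hT hN hstep.ae_grid hstep.ae_ok fun ij => curveSeg T N h ij.1 ij.2

lemma ηseg_map_eval (hT : 0 < T) (hN : 0 < N) {m : Measure (Euc d)}
    (hstep : LatticeStep T N (V (LASk T N V μ₀ h)) m R L) (t : ℝ) :
    (ηseg T N V μ₀ h).map (fun γ => γ t) = (V (LASk T N V μ₀ h)).map fun p =>
      curveSeg T N h (cellIdx₂ T N p).1 (cellIdx₂ T N p).2 t := by
  rw [ηseg_eq_map hT hN hstep,
    Measure.map_map (measurable_pi_apply t) (measurable_curveSeg_cellIdx₂ T N h)]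
  rfl

lemma ηseg_map_eval_left (hT : 0 < T) (hN : 0 < N) {m : Measure (Euc d)}
    (hstep : LatticeStep T N (V (LASk T N V μ₀ h)) m R L) :
    (ηseg T N V μ₀ h).map (fun γ => γ (h * (T / N))) = m := by
  rw [ηseg_map_eval hT hN hstep]
  refine Eq.trans (Measure.map_congr ?_) hstep.map_fst
  filter_upwards [hstep.ae_grid] with p hp
  have h₁ : gxE T N (cellIdx₂ T N p).1 = p.1 := gxE_cellIdx_of_mem_range hT hN hp
  simpa [curveSeg] using h₁

lemma ηseg_map_eval_right (hT : 0 < T) (hN : 0 < N) {m : Measure (Euc d)}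
    (hstep : LatticeStep T N (V (LASk T N V μ₀ h)) m R L) :
    (ηseg T N V μ₀ h).map (fun γ => γ ((h + 1 : ℕ) * (T / N))) = LASk T N V μ₀ (h + 1) := by
  rw [ηseg_map_eval hT hN hstep, LASk_succ_eq_map hT hN hstep]
  have : ((h + 1 : ℕ) : ℝ) * (T / N) - h * (T / N) = T / N := by push_cast; ring
  simp only [curveSeg, this]

lemma ηseg_map_eval_eq_LAS (hT : 0 < T) (hN : 0 < N) {m : Measure (Euc d)}
    (hstep : LatticeStep T N (V (LASk T N V μ₀ h)) m R L) {t : ℝ} (ht₀ : h * (T / N) < t)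
    (ht₁ : t ≤ (h + 1 : ℕ) * (T / N)) :
    (ηseg T N V μ₀ h).map (fun γ => γ t) = LAS T N V μ₀ t := by
  have hΔ : 0 < T / N := by positivity
  have hceil : ⌈t / (T / N)⌉.toNat - 1 = h := by
    have : ⌈t / (T / N)⌉ = ((h + 1 : ℕ) : ℤ) := by
      rw [Int.ceil_eq_iff, lt_div_iff₀ hΔ, div_le_iff₀ hΔ]
      push_cast at ht₁ ⊢
      exact ⟨by linarith, ht₁⟩
    rw [this, Int.toNat_natCast, Nat.add_sub_cancel]
  have ht : ¬ t ≤ 0 := not_le.mpr (lt_of_le_of_lt (by positivity) ht₀)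
  rw [ηseg_map_eval hT hN hstep, LAS, if_neg ht, hceil]
  exact (sum_mvc_eq_map hT hN hstep.ae_grid hstep.ae_ok
    fun ij => curveSeg T N h ij.1 ij.2 t).symm

lemma concentratedOn_ηseg (hT : 0 < T) (hN : 0 < N) {m : Measure (Euc d)}
    (hstep : LatticeStep T N (V (LASk T N V μ₀ h)) m R L) (hh : h ≤ N) :
    ConcentratedOn (lipCurves d L (R + T * L)) (ηseg T N V μ₀ h) := by
  rw [ηseg_eq_map hT hN hstep]
  refine concentratedOn_map_of_ae (measurable_curveSeg_cellIdx₂ T N h) ?_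
  filter_upwards [hstep.ae_grid, hstep.ae_norm_fst, hstep.ae_norm_velocity] with p h₁ h₂ h₃
  have h₄ : gxE T N (cellIdx₂ T N p).1 = p.1 := gxE_cellIdx_of_mem_range hT hN h₁
  constructor
  · refine LipschitzWith.of_dist_le_mul fun t u => ?_
    rw [dist_eq_norm, Real.dist_eq]
    have : curveSeg T N h (cellIdx₂ T N p).1 (cellIdx₂ T N p).2 t -
        curveSeg T N h (cellIdx₂ T N p).1 (cellIdx₂ T N p).2 u =
          (t - u) • gvE N (cellIdx₂ T N p).2 := by
      unfold curveSeg
      module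
    rw [this, norm_smul, Real.norm_eq_abs, mul_comm]
    gcongr
  · have hhT : (h : ℝ) * (T / N) ≤ T := by
      have : (h : ℝ) ≤ N := by exact_mod_cast hh
      calc (h : ℝ) * (T / N) ≤ N * (T / N) := by gcongr
        _ = T := by field_simp
    unfold curveSeg
    refine (norm_add_le _ _).trans ?_
    rw [h₄, norm_smul, zero_sub, norm_neg, Real.norm_of_nonneg (by positivity)]
    gcongr

/-- The concatenation construction represents the lattice approximate solution by a law of
uniformly Lipschitz curves. -/
theorem IsLASRep.concentratedOn_and_map_eval {ηN : Measure (Curve d)} (hT : 0 < T) (hN : 0 < N)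
    (hstep : ∀ h ≤ N, LatticeStep T N (V (LASk T N V μ₀ h)) (LASk T N V μ₀ h) R L)
    (hrep : IsLASRep T N V μ₀ ηN) :
    ConcentratedOn (lipCurves d L (R + T * L)) ηN ∧
      ∀ t ∈ Icc 0 T, ηN.map (fun γ => γ t) = LAS T N V μ₀ t := by
  obtain ⟨β, κ₀, κ₁, hβ1, hβ, rfl⟩ := hrep
  have hΔ : 0 < T / N := by positivity
  have hLAS : ∀ h ≤ N, LAS T N V μ₀ (h * (T / N)) = LASk T N V μ₀ h := by
    rintro (_ | h) hh
    · simp [LAS]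
    · rw [← ηseg_map_eval_right hT hN (hstep h (by lia)),
        ηseg_map_eval_eq_LAS hT hN (hstep h (by lia)) _ le_rfl]
      push_cast
      linarith
  have hgrid : ∀ h ≤ N, ∀ᵐ x ∂(LASk T N V μ₀ h), x ∈ range (gxE T N) := fun h hh => by
    rw [← (hstep h hh).map_fst]
    exact (ae_map_iff measurable_fst.aemeasurable
      (countable_range (gxE T N)).measurableSet).mpr (hstep h hh).ae_grid
  have key : ∀ h, 1 ≤ h → h ≤ N → ConcentratedOn (lipCurves d L (R + T * L)) (β h) ∧
      ∀ t ∈ Icc 0 (h * (T / N)), (β h).map (fun γ => γ t) = LAS T N V μ₀ t := by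
    intro h h1
    induction h, h1 using Nat.le_induction with
    | base =>
      intro hh
      rw [hβ1]
      refine ⟨concentratedOn_ηseg hT hN (hstep 0 (Nat.zero_le _)) (Nat.zero_le _), ?_⟩
      rintro t ⟨ht₀, ht₁⟩
      rcases ht₀.eq_or_lt with rfl | ht₀
      · have := ηseg_map_eval_left hT hN (hstep 0 (Nat.zero_le _))
        simpa [LAS] using this
      · exact ηseg_map_eval_eq_LAS hT hN (hstep 0 (Nat.zero_le _)) (by simpa using ht₀)
          (by simpa using ht₁)
    | succ h h1 ih =>
      intro hh
      have hhN : h ≤ N := by lia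
      obtain ⟨ihc, ihm⟩ := ih hhN
      obtain ⟨hd₀, hd₁, hsucc⟩ := hβ h h1 (by lia)
      have hs : 0 ≤ (h : ℝ) * (T / N) := by positivity
      have hm₀ : (β h).map (fun γ => γ (h * (T / N))) = LASk T N V μ₀ h := by
        rw [ihm _ ⟨hs, le_rfl⟩, hLAS h hhN]
      have hm₁ := ηseg_map_eval_left hT hN (hstep h hhN)
      rw [hsucc]
      refine ⟨concentratedOn_bind_merge hs hd₀ hm₀ hd₁ hm₁ (countable_range _) (hgrid h hhN) ihc
        (concentratedOn_ηseg hT hN (hstep h hhN) hhN), ?_⟩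
      rintro t ⟨ht₀, ht₁⟩
      rw [bind_merge_map_eval hd₀ hm₀ hd₁ hm₁ (countable_range _) (hgrid h hhN)]
      split_ifs with hts
      · exact ihm t ⟨ht₀, hts⟩
      · exact ηseg_map_eval_eq_LAS hT hN (hstep h hhN) (not_le.mp hts) ht₁
  have hNT : (N : ℝ) * (T / N) = T := by field_simp
  simpa only [hNT] using key N hN le_rfl

end Representation

section Limit

variable {d : ℕ}

lemma ConcentratedOn.ae_norm_eval_le {L : ℝ≥0} {R : ℝ} {ν : Measure (Curve d)}
    (h : ConcentratedOn (lipCurves d L R) ν) (t : ℝ) :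
    ∀ᵐ x ∂(ν.map fun γ => γ t), ‖x‖ ≤ R + L * |t| := by
  have ht : Measurable fun γ : Curve d => γ t := measurable_pi_apply t
  have hm : MeasurableSet {x : Euc d | ‖x‖ ≤ R + L * |t|} :=
    measurableSet_le measurable_norm measurable_const
  refine (ae_map_iff ht.aemeasurable hm).mpr ?_
  refine h _ (ht hm).compl ?_
  rw [disjoint_compl_left_iff_subset]
  rintro γ ⟨hγ, h0⟩
  have h1 := hγ.dist_le_mul t 0
  rw [dist_eq_norm, Real.dist_eq, sub_zero] at h1
  have := norm_le_norm_add_norm_sub' (γ t) (γ 0)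
  change ‖γ t‖ ≤ R + L * |t|
  linarith

lemma integrable_of_lipschitzWith_of_ae_norm_le {m : Measure (Euc d)} [IsFiniteMeasure m]
    {r : ℝ} (hm : ∀ᵐ x ∂m, ‖x‖ ≤ r) {K : ℝ≥0} {f : Euc d → ℝ} (hf : LipschitzWith K f) :
    Integrable f m := by
  refine Integrable.of_bound hf.continuous.aestronglyMeasurable (|f 0| + K * r) ?_
  filter_upwards [hm] with x hx
  have h1 := hf.dist_le_mul x 0
  rw [Real.dist_eq, dist_zero_right] at h1
  have h2 : (K : ℝ) * ‖x‖ ≤ K * r := by gcongr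
  have := norm_le_norm_add_norm_sub' (f x) (f 0)
  simp only [Real.norm_eq_abs] at this ⊢
  linarith

lemma integral_sub_integral_le_W1 {m n : Measure (Euc d)} [IsProbabilityMeasure m]
    [IsProbabilityMeasure n] {r : ℝ} (hm : ∀ᵐ x ∂m, ‖x‖ ≤ r) (hn : ∀ᵐ x ∂n, ‖x‖ ≤ r)
    {f : Euc d → ℝ} (hf : LipschitzWith 1 f) : (∫ x, f x ∂m) - ∫ x, f x ∂n ≤ W1 m n := by
  have hbdd : BddAbove (range fun f : {f : Euc d → ℝ // LipschitzWith 1 f} =>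
      (∫ x, f.1 x ∂m) - ∫ x, f.1 x ∂n) := by
    refine ⟨2 * r, ?_⟩
    rintro _ ⟨⟨g, hg⟩, rfl⟩
    have hgr : ∀ x, ‖x‖ ≤ r → |g x - g 0| ≤ r := fun x hx => by
      have h1 := hg.dist_le_mul x 0
      rw [Real.dist_eq, dist_zero_right, NNReal.coe_one, one_mul] at h1
      exact h1.trans hx
    have hmi : (∫ x, g x ∂m) ≤ ∫ _, g 0 + r ∂m := by
      refine integral_mono_ae (integrable_of_lipschitzWith_of_ae_norm_le hm hg)
        (integrable_const _) ?_
      filter_upwards [hm] with x hx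
      linarith [(abs_le.mp (hgr x hx)).2]
    have hni : (∫ _, g 0 - r ∂n) ≤ ∫ x, g x ∂n := by
      refine integral_mono_ae (integrable_const _)
        (integrable_of_lipschitzWith_of_ae_norm_le hn hg) ?_
      filter_upwards [hn] with x hx
      linarith [(abs_le.mp (hgr x hx)).1]
    simp only [integral_const, probReal_univ, one_smul] at hmi hni
    change (∫ x, g x ∂m) - ∫ x, g x ∂n ≤ 2 * r
    linarith
  exact le_ciSup hbdd ⟨f, hf⟩

lemma abs_integral_sub_integral_le_W1 {m n : Measure (Euc d)} [IsProbabilityMeasure m]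
    [IsProbabilityMeasure n] (hm : ∃ r : ℝ, ∀ᵐ x ∂m, ‖x‖ ≤ r) (hn : ∃ r : ℝ, ∀ᵐ x ∂n, ‖x‖ ≤ r)
    {K : ℝ≥0} {f : Euc d → ℝ} (hf : LipschitzWith K f) :
    |(∫ x, f x ∂m) - ∫ x, f x ∂n| ≤ (K + 1) * W1 m n := by
  obtain ⟨r₁, hm⟩ := hm
  obtain ⟨r₂, hn⟩ := hn
  replace hm : ∀ᵐ x ∂m, ‖x‖ ≤ max r₁ r₂ := hm.mono fun x hx => hx.trans (le_max_left _ _)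
  replace hn : ∀ᵐ x ∂n, ‖x‖ ≤ max r₁ r₂ := hn.mono fun x hx => hx.trans (le_max_right _ _)
  have hK : (0 : ℝ) < K + 1 := by positivity
  have hlip : ∀ c : ℝ, |c| = ((K : ℝ) + 1)⁻¹ → LipschitzWith 1 fun x => c * f x := fun c hc => by
    refine LipschitzWith.of_dist_le_mul fun x y => ?_
    have h := hf.dist_le_mul x y
    rw [Real.dist_eq] at h ⊢
    rw [← mul_sub, abs_mul, hc, NNReal.coe_one, one_mul, inv_mul_le_iff₀ hK]
    nlinarith [dist_nonneg (x := x) (y := y)]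
  have h₁ := integral_sub_integral_le_W1 hm hn (hlip ((K : ℝ) + 1)⁻¹ (abs_of_pos (by positivity)))
  have h₂ := integral_sub_integral_le_W1 hm hn
    (hlip (-((K : ℝ) + 1)⁻¹) (by rw [abs_neg, abs_of_pos (by positivity)]))
  simp only [integral_const_mul] at h₁ h₂
  rw [← mul_sub, inv_mul_le_iff₀ hK] at h₁
  rw [← mul_sub, neg_mul, ← mul_neg, inv_mul_le_iff₀ hK] at h₂
  exact abs_le.mpr ⟨by linarith, h₁⟩

lemma UnifCont.comp_eval {T t : ℝ} (ht : t ∈ Icc 0 T) {K : ℝ≥0} {f : Euc d → ℝ}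
    (hf : LipschitzWith K f) : UnifCont T fun γ : Curve d => f (γ t) := by
  intro γ ε hε
  obtain ⟨δ, hδ, H⟩ := Metric.continuous_iff.mp hf.continuous (γ t) ε hε
  refine ⟨δ, hδ, fun γ' h => ?_⟩
  rw [← Real.dist_eq]
  exact H _ (by rw [dist_eq_norm]; exact h t ht)

lemma measure_ext_of_forall_lipschitz_integral_eq {m n : Measure (Euc d)} [IsProbabilityMeasure m]
    [IsProbabilityMeasure n]
    (h : ∀ f : Euc d → ℝ, (∃ M, ∀ x, |f x| ≤ M) → (∃ K, LipschitzWith K f) →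
      ∫ x, f x ∂m = ∫ x, f x ∂n) : m = n := by
  let P : ProbabilityMeasure (Euc d) := ⟨m, inferInstance⟩
  let Q : ProbabilityMeasure (Euc d) := ⟨n, inferInstance⟩
  have hlim : Tendsto (fun _ : ℕ => P) atTop (𝓝 Q) := by
    rw [tendsto_iff_forall_lipschitz_integral_tendsto]
    rintro f ⟨C, hC⟩ hK
    have : ∫ x, f x ∂m = ∫ x, f x ∂n := h f ⟨|f 0| + C, fun x => by
      have h1 := hC x 0
      have := norm_le_norm_add_norm_sub' (f x) (f 0)
      rw [Real.dist_eq] at h1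
      simp only [Real.norm_eq_abs] at this
      linarith⟩ hK
    change Tendsto (fun _ : ℕ => ∫ x, f x ∂m) atTop (𝓝 (∫ x, f x ∂n))
    rw [this]
    exact tendsto_const_nhds
  have hPQ : P = Q := tendsto_nhds_unique tendsto_const_nhds hlim
  exact congrArg Subtype.val hPQ

end Limit

/-- Proposition `prop:reprLASok`, item (2): if the LASs `μ^N` converge
uniformly in time (for the Wasserstein metric) to a solution `μ` of the MDE, then the
probabilistic representations `η^N` of the LASs converge weakly-*, up to a subsequence, to
some `η`, which is a probabilistic representation of `μ`: `e_t ♯ η = μ_t` for all `t`. -/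
theorem LAS_representation_limit {d : ℕ} (T : ℝ) (hT : 0 < T)
    (V : Measure (Euc d) → Measure (Euc d × Euc d)) (hV : IsPVF V)
    (h1 : H1 V) (h2 : H2 V)
    (μ₀ : Measure (Euc d)) (hμ₀ : Pc μ₀)
    (μ : ℝ → Measure (Euc d)) (hμ : ∀ t ∈ Icc (0 : ℝ) T, Pc (μ t))
    (hsol : IsMDESol T V μ)
    (hconv : ∀ ε > 0, ∃ K : ℕ, ∀ N ≥ K, ∀ t ∈ Icc (0 : ℝ) T, W1 (LAS T N V μ₀ t) (μ t) < ε)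
    (η : ℕ → Measure (Curve d)) (hrep : ∀ N : ℕ, 1 ≤ N → IsLASRep T N V μ₀ (η N)) :
    ∃ φ : ℕ → ℕ, StrictMono φ ∧ ∃ ηlim : Measure (Curve d),
      IsProbabilityMeasure ηlim ∧
      (∀ f : Curve d → ℝ, Measurable f → (∃ M, ∀ γ, |f γ| ≤ M) → UnifCont T f →
        Tendsto (fun k => ∫ γ, f γ ∂(η (φ k))) atTop (𝓝 (∫ γ, f γ ∂ηlim))) ∧
      ∀ t ∈ Icc (0 : ℝ) T, ηlim.map (fun γ => γ t) = μ t := by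
  obtain ⟨R, L, N₀, hN₀, hstep⟩ := exists_latticeStep_LASk hT hV h1 hμ₀
  have hη : ∀ N ≥ N₀, ConcentratedOn (lipCurves d L (R + T * L)) (η N) ∧
      ∀ t ∈ Icc 0 T, (η N).map (fun γ => γ t) = LAS T N V μ₀ t := fun N hN =>
    (hrep N (hN₀.trans hN)).concentratedOn_and_map_eval hT (hN₀.trans hN) (hstep N hN)
  have hprob : ∀ N ≥ N₀, IsProbabilityMeasure (η N) := fun N hN => by
    have h0 := (hη N hN).2 0 ⟨le_rfl, hT.le⟩
    have hLAS : IsProbabilityMeasure (LAS T N V μ₀ 0) := by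
      rw [LAS, if_pos le_rfl]
      exact (hstep N hN 0 (Nat.zero_le _)).isProbabilityMeasure
    rw [← h0] at hLAS
    exact Measure.isProbabilityMeasure_of_map (fun γ : Curve d => γ 0)
  obtain ⟨φ, hφ, ηlim, hηlim, hlim⟩ := exists_subseq_tendsto_of_concentratedOn_lipCurves T
    (fun n => η (n + N₀)) (fun n => hprob _ (Nat.le_add_left _ _))
    (fun n => (hη _ (Nat.le_add_left _ _)).1)
  refine ⟨fun k => φ k + N₀, fun a b hab => Nat.add_lt_add_right (hφ hab) _, ηlim, hηlim, hlim,
    fun t ht => ?_⟩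
  have hev : Measurable fun γ : Curve d => γ t := measurable_pi_apply t
  have := (hμ t ht).1
  have := Measure.isProbabilityMeasure_map (μ := ηlim) hev.aemeasurable
  refine measure_ext_of_forall_lipschitz_integral_eq fun f ⟨M, hM⟩ ⟨K, hK⟩ => ?_
  have hint : ∀ ν : Measure (Curve d), ∫ x, f x ∂(ν.map fun γ => γ t) = ∫ γ, f (γ t) ∂ν :=
    fun ν => integral_map hev.aemeasurable hK.continuous.aestronglyMeasurable
  rw [hint]
  refine tendsto_nhds_unique (hlim (fun γ => f (γ t)) (hK.continuous.measurable.comp hev)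
    ⟨M, fun γ => hM _⟩ (UnifCont.comp_eval ht hK)) ?_
  rw [Metric.tendsto_atTop]
  intro ε hε
  have hK1 : (0 : ℝ) < K + 1 := by positivity
  obtain ⟨k₀, hk₀⟩ := hconv (ε / (K + 1)) (by positivity)
  refine ⟨k₀, fun k hk => ?_⟩
  have hN : φ k + N₀ ≥ N₀ := Nat.le_add_left _ _
  have hPη := hprob _ hN
  have := Measure.isProbabilityMeasure_map (μ := η (φ k + N₀)) hev.aemeasurable
  have hW := hk₀ (φ k + N₀) ((hk.trans (hφ.id_le k)).trans (Nat.le_add_right _ _)) t ht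
  rw [← (hη _ hN).2 t ht, lt_div_iff₀ hK1, mul_comm] at hW
  obtain ⟨r, -, hr⟩ := (hμ t ht).exists_ae_norm_le
  rw [← hint, Real.dist_eq]
  exact (abs_integral_sub_integral_le_W1 ⟨_, (hη _ hN).1.ae_norm_eval_le t⟩ ⟨r, hr⟩ hK).trans_lt hW

end
end
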